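/- Let T > 0, σ_Y > 0, γ° > 0. Let (β3, γP) be a pair of C¹ functions on [0,T] solving the public-case boundary value problem at r = 0: β3' = −β3²(1 − β3)·γP/σ_Y² with β3(T) = 1/2, γP' = −(γP)²β3²/σ_Y² with γP(0) = γ°, and with β3(t) ∈ (1/2, 1) for t ∈ [0,T). Let ᾱ ∈ (1/2, 1) be a constant and γN a C¹ function on [0,T] with γN' = −ᾱ²(γN)²/σ_Y², γN(0) = γ°, and ᾱ·(1 + γN(T)/γ°) = 1. Then β3(0) > ᾱ and γP(T) > γN(T). -/

import Mathlib

open Set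

theorem eqOn_const_of_hasDerivWithinAt_zero {f : ℝ → ℝ} {T : ℝ} (hT : 0 < T)
    (hf : ∀ t ∈ Icc (0:ℝ) T, HasDerivWithinAt f 0 (Icc 0 T) t) :
    ∀ t ∈ Icc (0:ℝ) T, f t = f 0 :=
  constant_of_derivWithin_zero (fun t ht => (hf t ht).differentiableWithinAt) fun t ht =>
    (hf t (Ico_subset_Icc_self ht)).derivWithin
      (uniqueDiffOn_Icc hT t (Ico_subset_Icc_self ht))

/-- A positive solution of `f' = -c f ^ 2` satisfies `1 / f T = 1 / f 0 + c T`. -/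
theorem inv_eq_of_hasDerivWithinAt_neg_mul_sq {f : ℝ → ℝ} {T c : ℝ} (hT : 0 < T)
    (hf : ∀ t ∈ Icc (0:ℝ) T, HasDerivWithinAt f (-c * f t ^ 2) (Icc 0 T) t)
    (hpos : ∀ t ∈ Icc (0:ℝ) T, 0 < f t) :
    (f T)⁻¹ = (f 0)⁻¹ + c * T := by
  have h := eqOn_const_of_hasDerivWithinAt_zero (f := fun t => (f t)⁻¹ - c * t) hT
    (fun t ht => by
      have hne := (hpos t ht).ne'
      refine (((hf t ht).inv hne).sub ((hasDerivWithinAt_id t _).const_mul c)).congr_deriv ?_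
      field_simp
      ring) T (right_mem_Icc.2 hT.le)
  simp only [mul_zero, sub_zero] at h
  linarith

/-- The terminal conditions of the two cases, with `τ = γ° T / σ ^ 2`: here `a` is the
no-feedback coefficient and `b` the initial public one. -/
theorem lt_and_lt_of_terminal_eq {a b τ : ℝ} (ha : 1 / 2 < a) (ha1 : a < 1)
    (hb : 1 / 2 < b)
    (hN : 2 * a - 1 = a ^ 2 * (1 - a) * τ) (hP : 2 * b - 1 = b * (1 - b) * τ) :
    a < b ∧ 1 - a < 2 * a * (1 - b) := by
  have hcross : (2 * b - 1) * (a ^ 2 * (1 - a)) = (2 * a - 1) * (b * (1 - b)) := by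
    rw [hN, hP]; ring
  have ha0 : 0 < 1 - a := by linarith
  constructor
  · by_contra! hba
    have hmono : (2 * b - 1) * (a * (1 - a)) ≤ (2 * a - 1) * (b * (1 - b)) := by
      nlinarith [mul_nonneg (sub_nonneg.2 hba) (show 0 ≤ 1 - a - b + 2 * a * b by nlinarith)]
    have hstrict : 0 < (2 * b - 1) * (a * (1 - a) * (1 - a)) :=
      mul_pos (by linarith) (mul_pos (mul_pos (by linarith) ha0) ha0)
    nlinarith
  · by_contra! hle
    have hquad : 4 * a ^ 2 * (b * (1 - b)) ≤ (1 - a) * (3 * a - 1) := by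
      nlinarith [mul_nonneg (sub_nonneg.2 hle)
        (show 0 ≤ 3 * a - 1 - 2 * a * (1 - b) by linarith)]
    have hcubic : (1 - a) * (3 * a - 1) < 4 * a ^ 3 * (1 - a) := by
      have : 0 < (1 - a) * ((a + 1) * (2 * a - 1) ^ 2) :=
        mul_pos ha0 (mul_pos (by linarith) (pow_pos (by linarith) 2))
      nlinarith
    have hlow : (2 * a - 1) * (a * (1 - a)) ≤ (2 * b - 1) * (a ^ 2 * (1 - a)) := by
      have : 0 ≤ (a * (1 - a)) * (1 - a - 2 * a * (1 - b)) :=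
        mul_nonneg (mul_nonneg (by linarith) ha0.le) (by linarith)
      nlinarith
    rw [hcross] at hlow
    have hdiv := le_of_mul_le_mul_left hlow (by linarith)
    nlinarith [mul_le_mul_of_nonneg_left hdiv (show 0 ≤ 4 * a ^ 2 by positivity)]

/-- At `r = 0`, the patient leader signals less aggressively at time zero without
feedback, yet the follower has learned more by `T`
(Cisternas–Kolb, Proposition "Total learning", part (i)). -/
theorem stmt_4 (T σY γo : ℝ) (hT : 0 < T) (hσY : 0 < σY) (hγo : 0 < γo)
    (β3 γP : ℝ → ℝ)
    (hβ3C1 : ContDiffOn ℝ 1 β3 (Icc 0 T))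
    (hγPC1 : ContDiffOn ℝ 1 γP (Icc 0 T))
    (hβ3ode : ∀ t ∈ Icc (0:ℝ) T,
      HasDerivWithinAt β3 (-(β3 t)^2 * (1 - β3 t) * γP t / σY^2) (Icc 0 T) t)
    (hβ3T : β3 T = 1/2)
    (hγPode : ∀ t ∈ Icc (0:ℝ) T,
      HasDerivWithinAt γP (-(γP t)^2 * (β3 t)^2 / σY^2) (Icc 0 T) t)
    (hγP0 : γP 0 = γo)
    (hβ3rng : ∀ t ∈ Ico (0:ℝ) T, 1/2 < β3 t ∧ β3 t < 1)
    (abar : ℝ) (habar : 1/2 < abar ∧ abar < 1)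
    (γN : ℝ → ℝ)
    (hγNC1 : ContDiffOn ℝ 1 γN (Icc 0 T))
    (hγNode : ∀ t ∈ Icc (0:ℝ) T,
      HasDerivWithinAt γN (-abar^2 * (γN t)^2 / σY^2) (Icc 0 T) t)
    (hγN0 : γN 0 = γo)
    (hterm : abar * (1 + γN T / γo) = 1) :
    abar < β3 0 ∧ γN T < γP T := by
  have h0 : (0:ℝ) ∈ Icc 0 T := left_mem_Icc.2 hT.le
  have hTm : T ∈ Icc 0 T := right_mem_Icc.2 hT.le
  obtain ⟨ha, ha1⟩ := habar
  have hb := (hβ3rng 0 ⟨le_rfl, hT⟩).1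
  have hinvariant : ∀ t ∈ Icc (0:ℝ) T, γP t * (1 - β3 t) = γP 0 * (1 - β3 0) :=
    eqOn_const_of_hasDerivWithinAt_zero hT fun t ht => by
      refine ((hγPode t ht).mul ((hβ3ode t ht).const_sub 1)).congr_deriv ?_
      ring
  have hβpos : ∀ t ∈ Icc (0:ℝ) T, 0 < β3 t := fun t ht => by
    rcases ht.2.eq_or_lt with rfl | h
    · rw [hβ3T]; norm_num
    · linarith [(hβ3rng t ⟨ht.1, h⟩).1]
  have hPinv := inv_eq_of_hasDerivWithinAt_neg_mul_sq (c := γo * (1 - β3 0) / σY ^ 2) hT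
    (fun t ht => by
      refine (hβ3ode t ht).congr_deriv ?_
      rw [← hγP0, ← hinvariant t ht]
      ring) hβpos
  have hP : 2 * β3 0 - 1 = β3 0 * (1 - β3 0) * (γo * T / σY ^ 2) := by
    have := hβpos 0 h0
    rw [hβ3T] at hPinv
    field_simp at hPinv ⊢
    linarith
  have hγNT : γN T = γo * (1 - abar) / abar := by
    field_simp at hterm ⊢
    linarith
  have hγNTpos : 0 < γN T := by
    rw [hγNT]
    exact div_pos (mul_pos hγo (by linarith)) (by linarith)
  have hanti : AntitoneOn γN (Icc 0 T) :=
    antitoneOn_of_hasDerivWithinAt_nonpos (convex_Icc 0 T)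
      (fun t ht => (hγNode t ht).continuousWithinAt)
      (fun t ht => (hγNode t (interior_subset ht)).mono interior_subset)
      (fun t _ => by
        have : 0 ≤ abar ^ 2 * γN t ^ 2 / σY ^ 2 := by positivity
        rw [neg_mul, neg_div]
        linarith)
  have hNinv := inv_eq_of_hasDerivWithinAt_neg_mul_sq (c := abar ^ 2 / σY ^ 2) hT
    (fun t ht => by
      refine (hγNode t ht).congr_deriv ?_
      ring) (fun t ht => hγNTpos.trans_le (hanti ht hTm ht.2))
  have hN : 2 * abar - 1 = abar ^ 2 * (1 - abar) * (γo * T / σY ^ 2) := by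
    have : 0 < 1 - abar := by linarith
    rw [hγNT, hγN0] at hNinv
    field_simp at hNinv ⊢
    linarith
  obtain ⟨hlt, hlearn⟩ := lt_and_lt_of_terminal_eq ha ha1 hb hN hP
  refine ⟨hlt, ?_⟩
  have hγPT : γP T = 2 * γo * (1 - β3 0) := by
    have := hinvariant T hTm
    rw [hβ3T, hγP0] at this
    linarith
  rw [hγNT, hγPT, div_lt_iff₀ (by linarith)]
  nlinarith [mul_lt_mul_of_pos_left hlearn hγo]
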